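/- arXiv:2506.13376 — 2 statements merged into one kernel-verified Lean document; each statement's English description precedes it below -/
import Mathlib

section
/- Let x₀ ∈ L and let V := {x₀ + g + ℓ·ω : g ∈ G, ℓ ∈ {0,1,2}} ⊆ L. If M ⊆ V satisfies −2c ≤ y − x ≤ 2c for all x, y ∈ M and M has exactly 5 elements, then there exists g ∈ G such that M = {x₀ + g, x₀ + g + 2ω} ∪ {x₀ + f + ω : f ∈ G, f ≠ g}. -/
noncomputable section

/-- The defining relations `2x₁ - c, 2x₂ - c, 2x₃ - c, p·x₄ - c` inside the free abelian
group on five generators `x₁, x₂, x₃, x₄, c` (realized as `Fin 5 → ℤ`). -/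
def rels (p : ℤ) : Set (Fin 5 → ℤ) :=
  { (2 : ℤ) • (Pi.single 0 1 : Fin 5 → ℤ) - Pi.single 4 1,
    (2 : ℤ) • (Pi.single 1 1 : Fin 5 → ℤ) - Pi.single 4 1,
    (2 : ℤ) • (Pi.single 2 1 : Fin 5 → ℤ) - Pi.single 4 1,
    p • (Pi.single 3 1 : Fin 5 → ℤ) - Pi.single 4 1 }

/-- The Geigle-Lenzing group `L` of type `(2,2,2,p)`: the free abelian group on
`x₁, x₂, x₃, x₄, c` modulo the subgroup generated by the relations. -/
abbrev Lgrp (p : ℤ) := (Fin 5 → ℤ) ⧸ AddSubgroup.closure (rels p)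

/-- The images of the five generators in `L`; indices `0,1,2,3` give `x₁,x₂,x₃,x₄`, and
index `4` gives the canonical element `c`. -/
def gen (p : ℤ) (i : Fin 5) : Lgrp p := QuotientAddGroup.mk (Pi.single i 1)

/-- The canonical element `c` of `L`. -/
def cel (p : ℤ) : Lgrp p := gen p 4

/-- The dualizing element `ω = c − x₁ − x₂ − x₃ − x₄`. -/
def omg (p : ℤ) : Lgrp p := cel p - gen p 0 - gen p 1 - gen p 2 - gen p 3

/-- The submonoid `L₊` of `L` generated by `x₁, x₂, x₃, x₄, c`. -/
def Lplus (p : ℤ) : AddSubmonoid (Lgrp p) := AddSubmonoid.closure (Set.range (gen p))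

/-- The partial order on `L`: `x ≤ y` iff `y − x ∈ L₊`. -/
def Lle (p : ℤ) (x y : Lgrp p) : Prop := y - x ∈ Lplus p

/-- The set `G = {0, x₁ − x₂, x₁ − x₃, x₂ − x₃} ⊆ L`. -/
def Gset (p : ℤ) : Set (Lgrp p) :=
  {0, gen p 0 - gen p 1, gen p 0 - gen p 2, gen p 1 - gen p 2}

theorem rel_coords (p : ℤ) (v : Fin 5 → ℤ) (hv : v ∈ AddSubgroup.closure (rels p)) :
    ∃ a b e d : ℤ, v 0 = 2 * a ∧ v 1 = 2 * b ∧ v 2 = 2 * e ∧ v 3 = p * d ∧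
      v 4 = -a - b - e - d := by
  induction hv using AddSubgroup.closure_induction with
  | mem x hx =>
    rcases hx with rfl | rfl | rfl | rfl
    · exact ⟨1, 0, 0, 0, by simp, by simp, by simp, by simp, by simp⟩
    · exact ⟨0, 1, 0, 0, by simp, by simp, by simp, by simp, by simp⟩
    · exact ⟨0, 0, 1, 0, by simp, by simp, by simp, by simp, by simp⟩
    · exact ⟨0, 0, 0, 1, by simp, by simp, by simp, by simp, by simp⟩
  | zero => exact ⟨0, 0, 0, 0, by simp⟩
  | add x y _ _ hx hy =>
    obtain ⟨a, b, e, d, h0, h1, h2, h3, h4⟩ := hx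
    obtain ⟨a', b', e', d', k0, k1, k2, k3, k4⟩ := hy
    refine ⟨a + a', b + b', e + e', d + d', ?_, ?_, ?_, ?_, ?_⟩ <;>
      simp only [Pi.add_apply, *] <;> ring
  | neg x _ hx =>
    obtain ⟨a, b, e, d, h0, h1, h2, h3, h4⟩ := hx
    refine ⟨-a, -b, -e, -d, ?_, ?_, ?_, ?_, ?_⟩ <;>
      simp only [Pi.neg_apply, *] <;> ring

theorem plus_rep (p : ℤ) (x : Lgrp p) (hx : x ∈ Lplus p) :
    ∃ v : Fin 5 → ℤ, (∀ i, 0 ≤ v i) ∧ (QuotientAddGroup.mk v : Lgrp p) = x := by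
  induction hx using AddSubmonoid.closure_induction with
  | mem x hx =>
    obtain ⟨i, rfl⟩ := hx
    refine ⟨Pi.single i 1, fun j => ?_, rfl⟩
    by_cases h : j = i
    · subst h; simp
    · simp [h]
  | zero => exact ⟨0, by simp, rfl⟩
  | add x y _ _ hx hy =>
    obtain ⟨v, hv, rfl⟩ := hx
    obtain ⟨w, hw, rfl⟩ := hy
    exact ⟨v + w, fun i => add_nonneg (hv i) (hw i), rfl⟩

theorem plus_coords (p : ℤ) (w : Fin 5 → ℤ) (h : (QuotientAddGroup.mk w : Lgrp p) ∈ Lplus p) :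
    ∃ a b e d : ℤ, 0 ≤ w 0 + 2 * a ∧ 0 ≤ w 1 + 2 * b ∧ 0 ≤ w 2 + 2 * e ∧
      0 ≤ w 3 + p * d ∧ 0 ≤ w 4 - a - b - e - d := by
  obtain ⟨v, hv, hvw⟩ := plus_rep p _ h
  obtain ⟨a, b, e, d, h0, h1, h2, h3, h4⟩ := rel_coords p _ (QuotientAddGroup.eq.1 hvw.symm)
  simp only [Pi.add_apply, Pi.neg_apply] at h0 h1 h2 h3 h4
  have := hv 0
  have := hv 1
  have := hv 2
  have := hv 3
  have := hv 4
  exact ⟨a, b, e, d, by omega, by omega, by omega, by omega, by omega⟩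

/-- Representative in the free group of `ω`. -/
def omgRep : Fin 5 → ℤ := ![-1, -1, -1, -1, 1]

theorem omg_eq (p : ℤ) : omg p = (QuotientAddGroup.mk omgRep : Lgrp p) := by
  have : omgRep = Pi.single 4 1 - Pi.single 0 1 - Pi.single 1 1 - Pi.single 2 1
      - Pi.single 3 1 := by
    ext i; fin_cases i <;> simp [omgRep]
  rw [this]; rfl

theorem cel_eq (p : ℤ) : cel p = (QuotientAddGroup.mk (![0, 0, 0, 0, 1]) : Lgrp p) := by
  have : (![0, 0, 0, 0, 1] : Fin 5 → ℤ) = Pi.single 4 1 := by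
    ext i; fin_cases i <;> simp
  rw [this]; rfl

theorem G_rep (p : ℤ) (g : Lgrp p) (hg : g ∈ Gset p) :
    ∃ v : Fin 5 → ℤ, g = (QuotientAddGroup.mk v : Lgrp p) ∧
      (v = ![0, 0, 0, 0, 0] ∨ v = ![1, -1, 0, 0, 0] ∨ v = ![1, 0, -1, 0, 0] ∨
        v = ![0, 1, -1, 0, 0]) := by
  rcases hg with rfl | rfl | rfl | rfl
  · refine ⟨_, ?_, Or.inl rfl⟩
    have : (![0, 0, 0, 0, 0] : Fin 5 → ℤ) = 0 := by
      ext i; fin_cases i <;> simp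
    rw [this]; rfl
  · refine ⟨_, ?_, Or.inr (Or.inl rfl)⟩
    have : (![1, -1, 0, 0, 0] : Fin 5 → ℤ) = Pi.single 0 1 - Pi.single 1 1 := by
      ext i; fin_cases i <;> simp
    rw [this]; rfl
  · refine ⟨_, ?_, Or.inr (Or.inr (Or.inl rfl))⟩
    have : (![1, 0, -1, 0, 0] : Fin 5 → ℤ) = Pi.single 0 1 - Pi.single 2 1 := by
      ext i; fin_cases i <;> simp
    rw [this]; rfl
  · refine ⟨_, ?_, Or.inr (Or.inr (Or.inr rfl))⟩
    have : (![0, 1, -1, 0, 0] : Fin 5 → ℤ) = Pi.single 1 1 - Pi.single 2 1 := by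
      ext i; fin_cases i <;> simp
    rw [this]; rfl

theorem omg_not (p : ℤ) (hp : 2 ≤ p) : ¬ Lle p (-((2 : ℤ) • cel p)) (omg p) := by
  intro h
  have h' : (QuotientAddGroup.mk (omgRep - -((2 : ℤ) • ![0, 0, 0, 0, 1])) : Lgrp p) ∈ Lplus p := by
    unfold Lle at h
    rw [omg_eq, cel_eq] at h
    exact h
  obtain ⟨a, b, e, d, h0, h1, h2, h3, h4⟩ := plus_coords p _ h'
  simp [omgRep] at h0 h1 h2 h3 h4
  have hd : 1 ≤ d := by
    by_contra hd
    nlinarith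
  omega

theorem two_omg_not (p : ℤ) (hp : 2 ≤ p) (f g : Lgrp p) (hf : f ∈ Gset p) (hg : g ∈ Gset p)
    (h : Lle p (-((2 : ℤ) • cel p)) (g - f + (2 : ℤ) • omg p)) : f = g := by
  obtain ⟨v, rfl, hv⟩ := G_rep p f hf
  obtain ⟨w, rfl, hw⟩ := G_rep p g hg
  have h' : (QuotientAddGroup.mk (w - v + (2 : ℤ) • omgRep - -((2 : ℤ) • ![0, 0, 0, 0, 1])) :
      Lgrp p) ∈ Lplus p := by
    unfold Lle at h
    rw [omg_eq, cel_eq] at h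
    exact h
  obtain ⟨a, b, e, d, h0, h1, h2, h3, h4⟩ := plus_coords p _ h'
  have hd : 0 ≤ -2 + p * d → 1 ≤ d := by
    intro h
    by_contra hd
    nlinarith
  rcases hv with rfl | rfl | rfl | rfl <;> rcases hw with rfl | rfl | rfl | rfl <;>
    first
    | rfl
    | (exfalso
       simp [omgRep] at h0 h1 h2 h3 h4
       have := hd (by linarith)
       omega)

theorem G_fin (p : ℤ) : (Gset p).Finite := by
  unfold Gset; simp

theorem G_card (p : ℤ) : (Gset p).ncard ≤ 4 := by
  unfold Gset
  refine (Set.ncard_insert_le _ _).trans ?_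
  refine Nat.succ_le_succ ((Set.ncard_insert_le _ _).trans ?_)
  refine Nat.succ_le_succ ((Set.ncard_insert_le _ _).trans ?_)
  simp

/-- If `M` is a subset of a `(ω,2)`-segment with `−2c ≤ y − x ≤ 2c` for all `x, y ∈ M`
and `M` has exactly `5` elements, then there exists `g ∈ G` with
`M = {x₀ + g, x₀ + g + 2ω} ∪ {x₀ + f + ω : f ∈ G, f ≠ g}`. -/
theorem stmt_11 (p : ℤ) (hp : 2 ≤ p) (x₀ : Lgrp p) (M : Set (Lgrp p))
    (hM : M ⊆ {z | ∃ g ∈ Gset p, ∃ l : ℤ, (l = 0 ∨ l = 1 ∨ l = 2) ∧ z = x₀ + g + l • omg p})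
    (hrig : ∀ x ∈ M, ∀ y ∈ M,
      Lle p (-((2 : ℤ) • cel p)) (y - x) ∧ Lle p (y - x) ((2 : ℤ) • cel p))
    (hcard : M.ncard = 5) :
    ∃ g ∈ Gset p, M = {x₀ + g, x₀ + g + (2 : ℤ) • omg p} ∪
      {z | ∃ f ∈ Gset p, f ≠ g ∧ z = x₀ + f + omg p} := by
  classical
  -- the three layers
  set A : ℤ → Set (Lgrp p) := fun l => {g | g ∈ Gset p ∧ x₀ + g + l • omg p ∈ M} with hA
  have hAG : ∀ l, A l ⊆ Gset p := fun l g hg => hg.1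
  have hAf : ∀ l, (A l).Finite := fun l => (G_fin p).subset (hAG l)
  have h01 : ∀ l g, g ∈ A l → g ∉ A (l + 1) := by
    intro l g h h'
    refine omg_not p hp ?_
    have := (hrig _ h.2 _ h'.2).1
    have e : x₀ + g + (l + 1) • omg p - (x₀ + g + l • omg p) = omg p := by
      rw [add_zsmul, one_zsmul]; abel
    rwa [e] at this
  have h02 : ∀ f g, f ∈ A 0 → g ∈ A 2 → f = g := by
    intro f g h h'
    refine two_omg_not p hp f g h.1 h'.1 ?_
    have := (hrig _ h.2 _ h'.2).1
    have e : x₀ + g + (2 : ℤ) • omg p - (x₀ + f + (0 : ℤ) • omg p)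
        = g - f + (2 : ℤ) • omg p := by
      rw [zero_smul]; abel
    rwa [e] at this
  have hMe : M = (fun g => x₀ + g + (0 : ℤ) • omg p) '' A 0 ∪
      (fun g => x₀ + g + (1 : ℤ) • omg p) '' A 1 ∪
      (fun g => x₀ + g + (2 : ℤ) • omg p) '' A 2 := by
    ext z
    constructor
    · intro hz
      obtain ⟨g, hg, l, hl, rfl⟩ := hM hz
      rcases hl with rfl | rfl | rfl
      · exact Or.inl (Or.inl ⟨g, ⟨hg, hz⟩, rfl⟩)
      · exact Or.inl (Or.inr ⟨g, ⟨hg, hz⟩, rfl⟩)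
      · exact Or.inr ⟨g, ⟨hg, hz⟩, rfl⟩
    · rintro ((⟨g, hg, rfl⟩ | ⟨g, hg, rfl⟩) | ⟨g, hg, rfl⟩) <;> exact hg.2
  have hle : 5 ≤ (A 0).ncard + (A 1).ncard + (A 2).ncard := by
    rw [← hcard, hMe]
    refine (Set.ncard_union_le _ _).trans (add_le_add ((Set.ncard_union_le _ _).trans
      (add_le_add ?_ ?_)) ?_) <;> exact Set.ncard_image_le (hAf _)
  have hsum : ∀ l, (A l).ncard + (A (l + 1)).ncard ≤ 4 := by
    intro l
    rw [← Set.ncard_union_eq (Set.disjoint_left.2 (h01 l)) (hAf _) (hAf _)]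
    exact (Set.ncard_le_ncard (Set.union_subset (hAG _) (hAG _)) (G_fin p)).trans (G_card p)
  have s01 : (A 0).ncard + (A 1).ncard ≤ 4 := hsum 0
  have s12 : (A 1).ncard + (A 2).ncard ≤ 4 := hsum 1
  obtain ⟨f, hf⟩ : (A 0).Nonempty := (Set.ncard_pos (hAf _)).1 (by omega)
  obtain ⟨g, hg⟩ : (A 2).Nonempty := (Set.ncard_pos (hAf _)).1 (by omega)
  obtain rfl := h02 f g hf hg
  have e0 : A 0 = {f} := Set.eq_singleton_iff_unique_mem.2 ⟨hf, fun y hy => h02 y f hy hg⟩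
  have e2 : A 2 = {f} := Set.eq_singleton_iff_unique_mem.2 ⟨hg, fun y hy => (h02 f y hf hy).symm⟩
  have hf1 : f ∉ A 1 := h01 0 f hf
  have c1 : 3 ≤ (A 1).ncard := by
    rw [e0, e2, Set.ncard_singleton] at hle
    omega
  have hins : insert f (A 1) = Gset p := by
    refine Set.eq_of_subset_of_ncard_le (Set.insert_subset hf.1 (hAG _)) ?_ (G_fin p)
    rw [Set.ncard_insert_of_notMem hf1 (hAf _)]
    exact (G_card p).trans (by omega)
  refine ⟨f, hf.1, ?_⟩
  ext z
  constructor
  · intro hz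
    rw [hMe, e0, e2] at hz
    rcases hz with (⟨g, rfl, rfl⟩ | ⟨g, hg', rfl⟩) | ⟨g, rfl, rfl⟩
    · left; left; simp
    · right
      exact ⟨g, hg'.1, fun h => hf1 (h ▸ hg'), by simp⟩
    · left; right; rfl
  · rintro ((rfl | rfl) | ⟨g, hgG, hne, rfl⟩)
    · simpa using hf.2
    · exact hg.2
    · rw [← hins] at hgG
      rcases hgG with h | h
      · exact absurd h hne
      · simpa using h.2
end
end

section
/- Let i, j, k_i, k_j be integers with 0 ≤ i ≤ j ≤ p − 2, k_j ≤ k_i and i + k_i ≤ j + k_j, and let g, h ∈ G with g ≠ h. Define the intervals 𝓛_g := {u ∈ L : (k_i − p − 1)·x₄ + g ≤ u ≤ (i + k_i)·x₄ + g} and 𝓡_h := {u ∈ L : ω + (j + k_j − p + 1)·x₄ + h ≤ u ≤ ω + (k_j + p)·x₄ + h}. Then for all x, y ∈ 𝓛_g ∪ 𝓡_h, one has −2c ≤ y − x ≤ 2c. -/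
noncomputable section

theorem key_aux {A : Type*} [AddCommGroup A] (a b e c g h : A)
    (h0 : (2 : ℤ) • a = c) (h1 : (2 : ℤ) • b = c) (h2 : (2 : ℤ) • e = c)
    (hg : g = 0 ∨ g = a - b ∨ g = a - e ∨ g = b - e)
    (hh : h = 0 ∨ h = a - b ∨ h = a - e ∨ h = b - e) (hne : g ≠ h) :
    g - h + a + b + e = c + a ∨ g - h + a + b + e = c + b ∨ g - h + a + b + e = c + e := by
  rcases hg with rfl | rfl | rfl | rfl <;> rcases hh with rfl | rfl | rfl | rfl <;>
    first
    | exact absurd rfl hne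
    | (left; grind)
    | (right; left; grind)
    | (right; right; grind)

theorem rel_aux (p : ℤ) (v : Fin 5 → ℤ) (n : ℤ) (k : Fin 5) (hv : v ∈ rels p)
    (e : v = n • (Pi.single k 1 : Fin 5 → ℤ) - Pi.single 4 1) : n • gen p k = cel p := by
  have h : (QuotientAddGroup.mk v : Lgrp p) = 0 :=
    (QuotientAddGroup.eq_zero_iff v).2 (AddSubgroup.subset_closure hv)
  rw [e] at h
  exact sub_eq_zero.1 h

theorem gen_mem (p : ℤ) (k : Fin 5) : gen p k ∈ Lplus p :=
  AddSubmonoid.subset_closure ⟨k, rfl⟩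

theorem zsmul_mem_aux (p n : ℤ) (hn : 0 ≤ n) (k : Fin 5) : n • gen p k ∈ Lplus p := by
  lift n to ℕ using hn
  rw [natCast_zsmul]
  exact AddSubmonoid.nsmul_mem _ (gen_mem p k) n

theorem width_aux (p : ℤ) (x y lo hi : Lgrp p) (hx : Lle p lo x) (hy : Lle p y hi)
    (hw : (2 : ℤ) • cel p - (hi - lo) ∈ Lplus p) : Lle p (y - x) ((2 : ℤ) • cel p) := by
  unfold Lle at *
  have := add_mem (add_mem hx hy) hw
  convert this using 1
  abel

theorem upper_aux (p : ℤ) (i j ki kj : ℤ)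
    (hi : 0 ≤ i) (hij : i ≤ j) (hj : j ≤ p - 2) (hk1 : kj ≤ ki) (hk2 : i + ki ≤ j + kj)
    (g h : Lgrp p) (hg : g ∈ Gset p) (hh : h ∈ Gset p) (hgh : g ≠ h)
    (x y : Lgrp p)
    (hx : x ∈ {u | Lle p ((ki - p - 1) • gen p 3 + g) u ∧ Lle p u ((i + ki) • gen p 3 + g)}
            ∪ {u | Lle p (omg p + (j + kj - p + 1) • gen p 3 + h) u ∧
                   Lle p u (omg p + (kj + p) • gen p 3 + h)})
    (hy : y ∈ {u | Lle p ((ki - p - 1) • gen p 3 + g) u ∧ Lle p u ((i + ki) • gen p 3 + g)}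
            ∪ {u | Lle p (omg p + (j + kj - p + 1) • gen p 3 + h) u ∧
                   Lle p u (omg p + (kj + p) • gen p 3 + h)}) :
    Lle p (y - x) ((2 : ℤ) • cel p) := by
  have h0 : (2 : ℤ) • gen p 0 = cel p := rel_aux p _ 2 0 (by simp [rels]) rfl
  have h1 : (2 : ℤ) • gen p 1 = cel p := rel_aux p _ 2 1 (by simp [rels]) rfl
  have h2 : (2 : ℤ) • gen p 2 = cel p := rel_aux p _ 2 2 (by simp [rels]) rfl
  have h3 : p • gen p 3 = cel p := rel_aux p _ p 3 (by simp [rels]) rfl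
  have kd : ∀ g h : Lgrp p, g ∈ Gset p → h ∈ Gset p → g ≠ h →
      ∃ d, g - h + gen p 0 + gen p 1 + gen p 2 = cel p + gen p d := by
    intro g h hg hh hgh
    rcases key_aux _ _ _ _ g h h0 h1 h2 hg hh hgh with q | q | q
    exacts [⟨0, q⟩, ⟨1, q⟩, ⟨2, q⟩]
  have fin : ∀ (n : ℤ) (v : Lgrp p), 0 ≤ n → v = n • gen p 3 → v ∈ Lplus p := by
    rintro n v hn rfl
    exact zsmul_mem_aux p n hn 3
  rcases hx with hx | hx <;> rcases hy with hy | hy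
  · refine width_aux p x y _ _ hx.1 hy.2 (fin (p - 1 - i) _ (by omega) ?_)
    rw [← h3]; module
  · refine width_aux p x y _ _ hx.1 hy.2 ?_
    obtain ⟨d, hd⟩ := kd g h hg hh hgh
    have : (ki - kj) • gen p 3 + gen p d ∈ Lplus p :=
      add_mem (zsmul_mem_aux p _ (by omega) 3) (gen_mem p d)
    convert this using 1
    have e : gen p d = g - h + gen p 0 + gen p 1 + gen p 2 - cel p := by rw [hd]; abel
    rw [e, omg, ← h3]; module
  · refine width_aux p x y _ _ hx.1 hy.2 ?_
    obtain ⟨d, hd⟩ := kd h g hh hg hgh.symm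
    have : (j + kj - i - ki) • gen p 3 + gen p d ∈ Lplus p :=
      add_mem (zsmul_mem_aux p _ (by omega) 3) (gen_mem p d)
    convert this using 1
    have e : gen p d = h - g + gen p 0 + gen p 1 + gen p 2 - cel p
        + (cel p - (2 : ℤ) • gen p 0) + (cel p - (2 : ℤ) • gen p 1)
        + (cel p - (2 : ℤ) • gen p 2) := by
      rw [hd, h0, h1, h2]; abel
    rw [e, omg, ← h3]; module
  · refine width_aux p x y _ _ hx.1 hy.2 (fin (j + 1) _ (by omega) ?_)
    rw [← h3]; module

/-- For any two elements `x, y` of `𝓛_g ∪ 𝓡_h` (the union of the left roofs of `(E_i, g)`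
and the right roofs of `(E_j, h)`), one has `−2c ≤ y − x ≤ 2c`. -/
theorem stmt_14 (p : ℤ) (hp : 2 ≤ p) (i j ki kj : ℤ)
    (hi : 0 ≤ i) (hij : i ≤ j) (hj : j ≤ p - 2) (hk1 : kj ≤ ki) (hk2 : i + ki ≤ j + kj)
    (g h : Lgrp p) (hg : g ∈ Gset p) (hh : h ∈ Gset p) (hgh : g ≠ h)
    (x y : Lgrp p)
    (hx : x ∈ {u | Lle p ((ki - p - 1) • gen p 3 + g) u ∧ Lle p u ((i + ki) • gen p 3 + g)}
            ∪ {u | Lle p (omg p + (j + kj - p + 1) • gen p 3 + h) u ∧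
                   Lle p u (omg p + (kj + p) • gen p 3 + h)})
    (hy : y ∈ {u | Lle p ((ki - p - 1) • gen p 3 + g) u ∧ Lle p u ((i + ki) • gen p 3 + g)}
            ∪ {u | Lle p (omg p + (j + kj - p + 1) • gen p 3 + h) u ∧
                   Lle p u (omg p + (kj + p) • gen p 3 + h)}) :
    Lle p (-((2 : ℤ) • cel p)) (y - x) ∧ Lle p (y - x) ((2 : ℤ) • cel p) := by
  have a1 := upper_aux p i j ki kj hi hij hj hk1 hk2 g h hg hh hgh x y hx hy
  have a2 := upper_aux p i j ki kj hi hij hj hk1 hk2 g h hg hh hgh y x hy hx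
  refine ⟨?_, a1⟩
  unfold Lle at *
  convert a2 using 1
  abel
end
end
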